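/- Consider the sparse linear regression model with all quantities k=k_n, p=p_n, τ=τ_n, σ=σ_n depending on n and asymptotics as n→∞. Assume k/p → 0 and (k·log p)/n → 0, and suppose τ/σ = o(√(log(p/k))) (Regimes I–II). Then the best subset selection estimator β̂^{BS} satisfies sup_{β∈Θ(k,τ)} E_β‖β̂^{BS} − β‖₂² / R(Θ(k,τ), σ) → ∞. -/

import Mathlib

open MeasureTheory ProbabilityTheory Filter
open scoped NNReal ENNReal

noncomputable section

/-- Joint law of the data: a design matrix with i.i.d. `N(0, (1/n) I_p)` rows
(entries i.i.d. `N(0, 1/n)`) and an independent noise vector with i.i.d. `N(0,1)` entries. -/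
def model (n p : ℕ) : Measure ((Fin n → Fin p → ℝ) × (Fin n → ℝ)) :=
  (Measure.pi fun _ : Fin n => Measure.pi fun _ : Fin p => gaussianReal 0 (n : ℝ≥0)⁻¹).prod
    (Measure.pi fun _ : Fin n => gaussianReal 0 1)

/-- Expected squared-error risk `E_β ‖est(X, Xβ + σ z) − β‖₂²` of an estimator `est`
under the true parameter `β` and noise level `σ`. -/
def risk (n p : ℕ) (σ : ℝ)
    (est : (Fin n → Fin p → ℝ) × (Fin n → ℝ) → Fin p → ℝ) (β : Fin p → ℝ) : ℝ≥0∞ :=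
  ∫⁻ ω, ENNReal.ofReal
      (∑ j, (est (ω.1, fun i => (∑ l, ω.1 i l * β l) + σ * ω.2 i) j - β j) ^ 2) ∂ model n p

/-- The `ℓ₀` norm: number of nonzero coordinates. -/
def l0norm {p : ℕ} (β : Fin p → ℝ) : ℕ := (Finset.univ.filter fun j => β j ≠ 0).card

/-- The SNR-aware sparse parameter space `Θ(k, τ)`. -/
def Theta (p k : ℕ) (τ : ℝ) : Set (Fin p → ℝ) :=
  {β | l0norm β ≤ k ∧ ∑ j, β j ^ 2 ≤ k * τ ^ 2}

/-- The minimax risk `R(Θ(k,τ), σ)`: infimum over measurable estimators of the supremum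
risk over `Θ(k,τ)`. -/
def minimaxRisk (n p k : ℕ) (τ σ : ℝ) : ℝ≥0∞ :=
  ⨅ (est : (Fin n → Fin p → ℝ) × (Fin n → ℝ) → Fin p → ℝ) (_ : Measurable est),
    ⨆ β ∈ Theta p k τ, risk n p σ est β

/-- The square of a centered Gaussian variable of variance `v` has exponential moment `√2`
at `1 / (4 v)`. -/
lemma lintegral_exp_sq_gaussianReal {v : ℝ≥0} (hv : v ≠ 0) :
    ∫⁻ x, ENNReal.ofReal (Real.exp (x ^ 2 / (4 * v))) ∂(gaussianReal 0 v)
      = ENNReal.ofReal (Real.sqrt 2) := by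
  rw [gaussianReal_of_var_ne_zero _ hv,
    lintegral_withDensity_eq_lintegral_mul _ (measurable_gaussianPDF 0 v) (by fun_prop)]
  have h2 : (2 * v) ≠ 0 := by simpa using hv
  have hv' : (0 : ℝ) < v := by positivity
  have key : ∀ x : ℝ, (gaussianPDF 0 v * fun x => ENNReal.ofReal (Real.exp (x ^ 2 / (4 * v)))) x
      = ENNReal.ofReal (Real.sqrt 2) * gaussianPDF 0 (2 * v) x := by
    intro x
    simp only [Pi.mul_apply, gaussianPDF]
    rw [← ENNReal.ofReal_mul (gaussianPDFReal_nonneg _ _ _), ← ENNReal.ofReal_mul (by positivity)]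
    congr 1
    simp only [gaussianPDFReal, sub_zero, NNReal.coe_mul, NNReal.coe_ofNat]
    have h1 : Real.sqrt (2 * Real.pi * (2 * v)) = Real.sqrt 2 * Real.sqrt (2 * Real.pi * v) := by
      rw [← Real.sqrt_mul (by norm_num)]
      congr 1
      ring
    rw [h1, mul_assoc, ← Real.exp_add]
    have h3 : -x ^ 2 / (2 * (v : ℝ)) + x ^ 2 / (4 * v) = -x ^ 2 / (2 * (2 * v)) := by
      field_simp
      ring
    rw [h3]
    have : Real.sqrt 2 ≠ 0 := by positivity
    field_simp
  simp_rw [key]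
  rw [lintegral_const_mul _ (measurable_gaussianPDF _ _), lintegral_gaussianPDF_eq_one _ h2, mul_one]

/-- A Gaussian tail lower bound. -/
lemma gaussianReal_Ici_ge {v : ℝ≥0} (hv : v ≠ 0) {u : ℝ} (hu : 0 ≤ u) :
    ENNReal.ofReal (Real.exp (-u ^ 2) / 7) ≤ gaussianReal 0 v (Set.Ici (u * Real.sqrt v)) := by
  have hv' : (0 : ℝ) < v := by positivity
  set s := Real.sqrt v with hs
  have hs0 : 0 < s := Real.sqrt_pos.2 hv'
  have hss : s ^ 2 = v := Real.sq_sqrt hv'.le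
  rw [gaussianReal_apply _ hv]
  calc ENNReal.ofReal (Real.exp (-u ^ 2) / 7)
      ≤ ENNReal.ofReal (Real.exp (-u ^ 2) / (7 * s)) * volume (Set.Icc (u * s) ((u + 1) * s)) := by
        rw [Real.volume_Icc, ← ENNReal.ofReal_mul (by positivity)]
        apply ENNReal.ofReal_le_ofReal
        have : Real.exp (-u ^ 2) / (7 * s) * ((u + 1) * s - u * s) = Real.exp (-u ^ 2) / 7 := by
          field_simp
          ring
        rw [this]
    _ = ∫⁻ x in Set.Icc (u * s) ((u + 1) * s), ENNReal.ofReal (Real.exp (-u ^ 2) / (7 * s)) := by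
        rw [setLIntegral_const]
    _ ≤ ∫⁻ x in Set.Icc (u * s) ((u + 1) * s), gaussianPDF 0 v x := by
        refine setLIntegral_mono (measurable_gaussianPDF 0 v) fun x hx => ?_
        apply ENNReal.ofReal_le_ofReal
        have hx0 : 0 ≤ x := le_trans (by positivity) hx.1
        have hx2 : x ^ 2 ≤ ((u + 1) * s) ^ 2 := pow_le_pow_left₀ hx0 hx.2 2
        have h1 : -u ^ 2 - 1 ≤ -x ^ 2 / (2 * v) := by
          rw [le_div_iff₀ (by positivity), ← hss]
          nlinarith [mul_nonneg (sq_nonneg (u - 1)) (sq_nonneg s)]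
        have hpi : Real.sqrt (2 * Real.pi * v) ≤ 2.51 * s := by
          rw [hs, ← Real.sqrt_sq (show (0 : ℝ) ≤ 2.51 by norm_num), ← Real.sqrt_mul (by positivity)]
          apply Real.sqrt_le_sqrt
          have := Real.pi_lt_d2
          nlinarith
        simp only [gaussianPDFReal, sub_zero]
        calc Real.exp (-u ^ 2) / (7 * s)
            ≤ (2.51 * s)⁻¹ * Real.exp (-u ^ 2 - 1) := by
              rw [sub_eq_add_neg, Real.exp_add, Real.exp_neg 1]
              have := Real.exp_one_lt_d9
              have h3 : 2.51 * Real.exp 1 ≤ 7 := by linarith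
              have h4 : (7 : ℝ)⁻¹ ≤ (2.51 * Real.exp 1)⁻¹ := inv_anti₀ (by positivity) h3
              calc Real.exp (-u ^ 2) / (7 * s) = (Real.exp (-u ^ 2) / s) * 7⁻¹ := by field_simp
                _ ≤ (Real.exp (-u ^ 2) / s) * (2.51 * Real.exp 1)⁻¹ := by gcongr
                _ = _ := by field_simp
          _ ≤ (Real.sqrt (2 * Real.pi * v))⁻¹ * Real.exp (-x ^ 2 / (2 * v)) := by
              gcongr
    _ ≤ ∫⁻ x in Set.Ici (u * s), gaussianPDF 0 v x :=
        lintegral_mono_set Set.Icc_subset_Ici_self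

/-- A linear combination of i.i.d. centered Gaussian variables is Gaussian. -/
lemma map_sum_mul_gaussianReal {Ω ι : Type*} [MeasurableSpace Ω] [Fintype ι] {P : Measure Ω}
    [IsProbabilityMeasure P] {f : ι → Ω → ℝ} {v : ℝ≥0} (hf : ∀ i, Measurable (f i))
    (hlaw : ∀ i, P.map (f i) = gaussianReal 0 v) (hind : iIndepFun f P) (c : ι → ℝ) :
    P.map (fun ω => ∑ i, c i * f i ω) = gaussianReal 0 (v * (∑ i, c i ^ 2)).toNNReal := by
  have hG : ∀ i, HasGaussianLaw (fun ω => c i * f i ω) P := fun i => by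
    have : HasGaussianLaw (f i) P := ⟨by rw [hlaw i]; infer_instance⟩
    simpa using this.fun_smul (c i)
  have hI : iIndepFun (fun i ω => c i * f i ω) P :=
    hind.comp (fun i x => c i * x) (fun i => by fun_prop)
  have hint : ∀ i, Integrable (fun ω => c i * f i ω) P := fun i => (hG i).integrable
  have hmean : ∀ i, ∫ ω, f i ω ∂P = 0 := fun i => by
    have := integral_map (μ := P) (hf i).aemeasurable (f := fun x : ℝ => x) (by fun_prop)
    rw [hlaw i, integral_id_gaussianReal] at this
    exact this.symm
  have hvar : ∀ i, Var[f i; P] = v := fun i => by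
    have := variance_map (μ := P) (Y := f i) (X := fun x : ℝ => x) (by fun_prop) (hf i).aemeasurable
    rw [hlaw i, variance_fun_id_gaussianReal] at this
    exact this.symm
  rw [(hI.hasGaussianLaw_fun_sum hG).map_eq_gaussianReal]
  congr 1
  · rw [integral_finsetSum _ fun i _ => hint i]
    simp [integral_const_mul, hmean]
  · congr 1
    have h := IndepFun.variance_sum (μ := P) (X := fun i ω => c i * f i ω) (s := Finset.univ)
      (fun i _ => (hG i).memLp_two) (fun i _ j _ hij => hI.indepFun hij)
    have h2 : (∑ i, fun ω => c i * f i ω) = fun ω => ∑ i, c i * f i ω := by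
      ext ω
      simp
    rw [h2] at h
    rw [h, Finset.mul_sum]
    refine Finset.sum_congr rfl fun i _ => ?_
    rw [variance_const_mul, hvar]
    ring

/-- The law of the design matrix: i.i.d. entries `N(0, 1/n)`. -/
def designMeasure (n p : ℕ) : Measure (Fin n → Fin p → ℝ) :=
  Measure.pi fun _ : Fin n => Measure.pi fun _ : Fin p => gaussianReal 0 (n : ℝ≥0)⁻¹

instance (n p : ℕ) : IsProbabilityMeasure (designMeasure n p) := by
  unfold designMeasure
  infer_instance

lemma map_row_designMeasure (n p : ℕ) (i : Fin n) :
    (designMeasure n p).map (fun X => X i) =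
      Measure.pi fun _ : Fin p => gaussianReal 0 (n : ℝ≥0)⁻¹ :=
  (measurePreserving_eval (fun _ : Fin n => Measure.pi fun _ : Fin p =>
    gaussianReal 0 (n : ℝ≥0)⁻¹) i).map_eq

lemma map_entry_designMeasure (n p : ℕ) (i : Fin n) (j : Fin p) :
    (designMeasure n p).map (fun X => X i j) = gaussianReal 0 (n : ℝ≥0)⁻¹ := by
  have h := (measurePreserving_eval (fun _ : Fin p => gaussianReal 0 (n : ℝ≥0)⁻¹) j).map_eq
  rw [← map_row_designMeasure n p i, Measure.map_map (by fun_prop) (by fun_prop)] at h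
  exact h

lemma iIndepFun_entry_designMeasure (n p : ℕ) :
    iIndepFun (fun (q : Fin n × Fin p) (X : Fin n → Fin p → ℝ) => X q.1 q.2)
      (designMeasure n p) := by
  have h := iIndepFun_uncurry_infinitePi' (fun (_ : Fin n) (_ : Fin p) =>
    gaussianReal 0 (n : ℝ≥0)⁻¹) (X := fun _ _ x => x) (by fun_prop)
  simp only [Measure.infinitePi_eq_pi] at h
  exact h

/-- The inner products of `y` with a column of the design. -/
def score {n p : ℕ} (X : Fin n → Fin p → ℝ) (y : Fin n → ℝ) (j : Fin p) : ℝ :=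
  ∑ i, y i * X i j

lemma measurable_score {n p : ℕ} (y : Fin n → ℝ) (j : Fin p) :
    Measurable fun X : Fin n → Fin p → ℝ => score X y j := by
  unfold score
  fun_prop

lemma map_score_designMeasure {n p : ℕ} (y : Fin n → ℝ) (j : Fin p) :
    (designMeasure n p).map (fun X => score X y j) =
      gaussianReal 0 ((∑ i, y i ^ 2) / n).toNNReal := by
  have hI := (iIndepFun_entry_designMeasure n p).precomp (g := fun i : Fin n => (i, j))
    (fun a b h => by simpa using h)
  have h := map_sum_mul_gaussianReal (P := designMeasure n p)
    (f := fun (i : Fin n) (X : Fin n → Fin p → ℝ) => X i j) (by fun_prop)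
    (fun i => map_entry_designMeasure n p i j) hI y
  unfold score
  rw [h]
  congr 2
  push_cast
  ring

lemma indepFun_score_designMeasure {n p : ℕ} (y : Fin n → ℝ) {j l : Fin p} (hjl : j ≠ l) :
    IndepFun (fun X => score X y j) (fun X => score X y l) (designMeasure n p) := by
  classical
  have h := (iIndepFun_entry_designMeasure n p).indepFun_finset
    (Finset.univ.image fun i : Fin n => (i, j)) (Finset.univ.image fun i : Fin n => (i, l))
    (by
      rw [Finset.disjoint_left]
      intro q hq hq'
      simp only [Finset.mem_image, Finset.mem_univ, true_and] at hq hq'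
      obtain ⟨a, rfl⟩ := hq
      obtain ⟨b, hb⟩ := hq'
      exact hjl (Prod.ext_iff.1 hb).2.symm) (by fun_prop)
  have hmem : ∀ (m : Fin p) (i : Fin n), (i, m) ∈ Finset.univ.image fun i : Fin n => (i, m) :=
    fun m i => Finset.mem_image_of_mem _ (Finset.mem_univ i)
  exact h.comp (φ := fun w => ∑ i, y i * w ⟨(i, j), hmem j i⟩)
    (ψ := fun w => ∑ i, y i * w ⟨(i, l), hmem l i⟩) (by fun_prop) (by fun_prop)

/-- Markov bound for the sum of the exponentials of the squared normalised scores. -/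
lemma designMeasure_sum_exp_ge_le {n p : ℕ} (y : Fin n → ℝ) {v c : ℝ} (hc : 0 < c)
    (hv : (∑ i, y i ^ 2) / n = v) (hv0 : 0 < v) :
    designMeasure n p {X | c ≤ ∑ j, Real.exp (score X y j ^ 2 / (4 * v))} ≤
      ENNReal.ofReal (Real.sqrt 2 * p / c) := by
  have hone : ∀ j : Fin p, ∫⁻ X, ENNReal.ofReal (Real.exp (score X y j ^ 2 / (4 * v)))
      ∂designMeasure n p = ENNReal.ofReal (Real.sqrt 2) := fun j => by
    rw [← lintegral_exp_sq_gaussianReal (v := v.toNNReal) (by simpa using hv0), ← hv,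
      ← map_score_designMeasure y j, lintegral_map (by fun_prop) (measurable_score y j), hv,
      Real.coe_toNNReal _ hv0.le]
  have hms : ∀ j : Fin p, Measurable fun X : Fin n → Fin p → ℝ =>
      ENNReal.ofReal (Real.exp (score X y j ^ 2 / (4 * v))) := fun j => by
    have := measurable_score (n := n) (p := p) y j
    fun_prop
  have h := meas_ge_le_lintegral_div (μ := designMeasure n p)
    (f := fun X => ∑ j, ENNReal.ofReal (Real.exp (score X y j ^ 2 / (4 * v))))
    (Finset.measurable_sum _ fun j _ => hms j).aemeasurable
    (ε := ENNReal.ofReal c) (by simpa using hc) (by simp)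
  rw [lintegral_finsetSum _ fun j _ => hms j] at h
  simp only [hone, Finset.sum_const, Finset.card_univ, Fintype.card_fin, nsmul_eq_mul] at h
  refine (measure_mono fun X hX => ?_).trans (h.trans_eq ?_)
  · simp only [Set.mem_ofPred_eq] at hX ⊢
    rw [← ENNReal.ofReal_sum_of_nonneg fun j _ => by positivity]
    exact ENNReal.ofReal_le_ofReal hX
  · rw [ENNReal.ofReal_div_of_pos hc, ENNReal.ofReal_mul (by positivity), ENNReal.ofReal_natCast,
      mul_comm]

/-- Second moment bound: among pairwise independent events of equal probability at least `q`,
at least half the expected number occurs with high probability. -/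
lemma measure_card_lt_le {Ω : Type*} [MeasurableSpace Ω] {P : Measure Ω} [IsProbabilityMeasure P]
    {p : ℕ} {g : Fin p → Ω → ℝ} (hg : ∀ j, Measurable (g j))
    (hind : ∀ j l, j ≠ l → IndepFun (g j) (g l) P) {t q : ℝ} {k : ℕ} (hp : 0 < p) (hq : 0 < q)
    {ν : Measure ℝ} (hlaw : ∀ j, P.map (g j) = ν) (hν : ENNReal.ofReal q ≤ ν (Set.Ici t))
    (hk : 2 * (k : ℝ) ≤ p * q) :
    P {ω | (Finset.univ.filter fun j => t ≤ g j ω).card < k} ≤ ENNReal.ofReal (4 / (p * q)) := by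
  classical
  set Y : Fin p → Ω → ℝ := fun j ω => (Set.Ici t).indicator (fun _ => (1 : ℝ)) (g j ω) with hY
  have hYm : ∀ j, Measurable (Y j) := fun j =>
    (measurable_const.indicator measurableSet_Ici).comp (hg j)
  have hYb : ∀ j ω, ‖Y j ω‖ ≤ 1 := fun j ω => by
    simp only [hY, Set.indicator]
    split_ifs <;> simp
  have hYL : ∀ j, MemLp (Y j) 2 P := fun j =>
    MemLp.of_bound (hYm j).aestronglyMeasurable 1 (ae_of_all _ (hYb j))
  have hYI : ∀ j l, j ≠ l → IndepFun (Y j) (Y l) P := fun j l hjl =>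
    (hind j l hjl).comp (measurable_const.indicator measurableSet_Ici)
      (measurable_const.indicator measurableSet_Ici)
  set Q : ℝ := ν.real (Set.Ici t) with hQ
  have hν1 : IsProbabilityMeasure ν := by
    rw [← hlaw ⟨0, hp⟩]
    exact Measure.isProbabilityMeasure_map (hg _).aemeasurable
  have hqQ : q ≤ Q := by
    rw [hQ, Measure.real]
    exact (ENNReal.ofReal_le_iff_le_toReal (measure_ne_top _ _)).1 hν
  have hmean : ∀ j, ∫ ω, Y j ω ∂P = Q := fun j => by
    have h := integral_map (μ := P) (hg j).aemeasurable
      (f := (Set.Ici t).indicator fun _ => (1 : ℝ))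
      (measurable_const.indicator measurableSet_Ici).aestronglyMeasurable
    rw [hlaw j, integral_indicator_const _ measurableSet_Ici, smul_eq_mul, mul_one] at h
    exact h.symm
  have hvar : ∀ j, Var[Y j; P] ≤ Q := fun j => by
    refine (variance_le_expectation_sq (hYm j).aestronglyMeasurable).trans_eq ?_
    rw [← hmean j]
    refine integral_congr_ae (ae_of_all _ fun ω => ?_)
    simp only [hY, Set.indicator, Pi.pow_apply]
    split_ifs <;> simp
  set N : Ω → ℝ := ∑ j, Y j with hN
  have hNL : MemLp N 2 P := memLp_finsetSum' _ fun j _ => hYL j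
  have hNmean : ∫ ω, N ω ∂P = p * Q := by
    simp only [hN, Finset.sum_apply]
    rw [integral_finsetSum _ fun j _ => (hYL j).integrable one_le_two]
    simp [hmean]
  have hNvar : Var[N; P] ≤ p * Q := by
    rw [hN, IndepFun.variance_sum (fun j _ => hYL j) (fun j _ l _ hjl => hYI j l hjl)]
    exact (Finset.sum_le_sum fun j _ => hvar j).trans_eq (by simp)
  have hNcard : ∀ ω, N ω = (Finset.univ.filter fun j => t ≤ g j ω).card := fun ω => by
    simp [hN, hY, Set.indicator, Finset.sum_apply]
  have hp' : (0 : ℝ) < p := by exact_mod_cast hp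
  have hpq : 0 < p * q := by positivity
  have hpQ : p * q ≤ p * Q := by gcongr
  have hpQ0 : 0 < p * Q := hpq.trans_le hpQ
  refine (measure_mono fun ω hω => ?_).trans
    ((meas_ge_le_variance_div_sq hNL (c := p * Q / 2) (by positivity)).trans
      (ENNReal.ofReal_le_ofReal ?_))
  · simp only [Set.mem_ofPred_eq] at hω ⊢
    have hω' : N ω < k := by
      rw [hNcard]
      exact_mod_cast hω
    rw [hNmean, abs_sub_comm]
    refine le_trans ?_ (le_abs_self _)
    linarith
  · calc Var[N; P] / (p * Q / 2) ^ 2 ≤ (p * Q) / (p * Q / 2) ^ 2 := by gcongr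
      _ = 4 / (p * Q) := by field_simp; norm_num
      _ ≤ 4 / (p * q) := by gcongr

/-- Chernoff bound for the squared norm of a sum of `k` columns of the design. -/
lemma designMeasure_sq_norm_sum_gt_le {n p k : ℕ} (hn : 0 < n) (hk : 0 < k) (S : Finset (Fin p))
    (hS : S.card = k) :
    designMeasure n p {X | 4 * (k : ℝ) < ∑ i, (∑ j ∈ S, X i j) ^ 2} ≤
      ENNReal.ofReal (Real.exp (-(n / 2 : ℝ))) := by
  have hn' : (0 : ℝ) < n := by exact_mod_cast hn
  have hk' : (0 : ℝ) < k := by exact_mod_cast hk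
  have hlaw : ∀ i : Fin n, (designMeasure n p).map (fun X => ∑ j ∈ S, X i j) =
      gaussianReal 0 (k / n : ℝ).toNNReal := fun i => by
    classical
    have hI := (iIndepFun_entry_designMeasure n p).precomp (g := fun j : Fin p => (i, j))
      (fun a b h => by simpa using h)
    have h := map_sum_mul_gaussianReal (P := designMeasure n p)
      (f := fun (j : Fin p) (X : Fin n → Fin p → ℝ) => X i j) (by fun_prop)
      (fun j => map_entry_designMeasure n p i j) hI (fun j => if j ∈ S then 1 else 0)
    simp only [ite_mul, one_mul, zero_mul, Finset.sum_ite_mem, Finset.univ_inter, ite_pow, one_pow,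
      ne_eq, OfNat.ofNat_ne_zero, not_false_eq_true, zero_pow, Finset.sum_const, hS, nsmul_eq_mul,
      mul_one] at h
    rw [h]
    congr 2
    push_cast
    ring
  have hrow : iIndepFun (fun (i : Fin n) (X : Fin n → Fin p → ℝ) =>
      ENNReal.ofReal (Real.exp ((∑ j ∈ S, X i j) ^ 2 / (4 * (k / n : ℝ))))) (designMeasure n p) :=
    iIndepFun_pi (X := fun _ (x : Fin p → ℝ) =>
      ENNReal.ofReal (Real.exp ((∑ j ∈ S, x j) ^ 2 / (4 * (k / n : ℝ))))) (by fun_prop)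
  have hone : ∀ i : Fin n, ∫⁻ X, ENNReal.ofReal (Real.exp ((∑ j ∈ S, X i j) ^ 2 / (4 * (k / n : ℝ))))
      ∂designMeasure n p = ENNReal.ofReal (Real.sqrt 2) := fun i => by
    have hkn : (0 : ℝ) < k / n := by positivity
    rw [← lintegral_exp_sq_gaussianReal (v := (k / n : ℝ).toNNReal) (by simpa using hkn),
      ← hlaw i, lintegral_map (by fun_prop) (by fun_prop), Real.coe_toNNReal _ hkn.le]
  have hprod := lintegral_prod_eq_prod_lintegral_of_indepFun Finset.univ _ hrow (by fun_prop)
  simp only [hone, Finset.prod_const, Finset.card_univ, Fintype.card_fin] at hprod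
  have h := meas_ge_le_lintegral_div (μ := designMeasure n p)
    (f := fun X => ∏ i, ENNReal.ofReal (Real.exp ((∑ j ∈ S, X i j) ^ 2 / (4 * (k / n : ℝ)))))
    (Finset.measurable_prod _ fun i _ => by fun_prop).aemeasurable
    (ε := ENNReal.ofReal (Real.exp n)) (by simp [Real.exp_pos]) (by simp)
  rw [hprod] at h
  refine (measure_mono fun X hX => ?_).trans (h.trans ?_)
  · simp only [Set.mem_ofPred_eq] at hX ⊢
    rw [← ENNReal.ofReal_prod_of_nonneg fun i _ => by positivity, ← Real.exp_sum,
      ← Finset.sum_div]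
    apply ENNReal.ofReal_le_ofReal
    apply Real.exp_le_exp.2
    rw [le_div_iff₀ (by positivity)]
    calc (n : ℝ) * (4 * (k / n)) = 4 * k := by field_simp
      _ ≤ _ := hX.le
  · rw [← ENNReal.ofReal_pow (by positivity), ← ENNReal.ofReal_div_of_pos (Real.exp_pos _)]
    apply ENNReal.ofReal_le_ofReal
    have h2 : Real.sqrt 2 ≤ Real.exp (1 / 2) := by
      rw [Real.sqrt_le_left (by positivity), ← Real.exp_nat_mul]
      have := Real.add_one_le_exp (1 : ℝ)
      norm_num at this ⊢
      exact this
    calc Real.sqrt 2 ^ n / Real.exp n ≤ Real.exp (1 / 2) ^ n / Real.exp n := by gcongr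
      _ = Real.exp (-(n / 2 : ℝ)) := by
        rw [← Real.exp_nat_mul, ← Real.exp_sub]
        congr 1
        ring

/-- Union bound over all sums of `k` columns of the design. -/
lemma designMeasure_exists_sq_norm_sum_gt_le {n p k : ℕ} (hn : 0 < n) (hk : 0 < k) (hp : 0 < p) :
    designMeasure n p {X | ∃ S : Finset (Fin p), S.card = k ∧
      4 * (k : ℝ) < ∑ i, (∑ j ∈ S, X i j) ^ 2} ≤
      ENNReal.ofReal (Real.exp (k * Real.log p - n / 2)) := by
  have hsub : {X : Fin n → Fin p → ℝ | ∃ S : Finset (Fin p), S.card = k ∧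
      4 * (k : ℝ) < ∑ i, (∑ j ∈ S, X i j) ^ 2} ⊆
      ⋃ S ∈ (Finset.univ : Finset (Fin p)).powersetCard k,
        {X | 4 * (k : ℝ) < ∑ i, (∑ j ∈ S, X i j) ^ 2} := by
    rintro X ⟨S, hS, hX⟩
    simp only [Set.mem_iUnion]
    exact ⟨S, by simp [hS], hX⟩
  refine (measure_mono hsub).trans ((measure_biUnion_finset_le _ _).trans ?_)
  refine (Finset.sum_le_sum fun S hS => designMeasure_sq_norm_sum_gt_le hn hk S
    (Finset.mem_powersetCard.1 hS).2).trans ?_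
  rw [Finset.sum_const, Finset.card_powersetCard, Finset.card_univ, Fintype.card_fin,
    nsmul_eq_mul, ← ENNReal.ofReal_natCast, ← ENNReal.ofReal_mul (by positivity), sub_eq_add_neg,
    Real.exp_add, Real.exp_nat_mul, Real.exp_log (by exact_mod_cast hp)]
  apply ENNReal.ofReal_le_ofReal
  gcongr
  exact_mod_cast Nat.choose_le_pow p k

/-- A best subset fit on `k`-sparse vectors is large as soon as `k` scores are large, sums of `k`
columns are not too long and the scores have a bounded exponential moment. -/
lemma le_sum_sq_of_best_subset {n p k : ℕ} {X : Fin n → Fin p → ℝ} {y : Fin n → ℝ}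
    {b : Fin p → ℝ} {v L : ℝ} (hk : 0 < k) (hv : 0 < v) (hL : 1 ≤ L) (hb : l0norm b ≤ k)
    (hopt : ∀ b' : Fin p → ℝ, l0norm b' ≤ k →
      ∑ i, (y i - ∑ j, X i j * b j) ^ 2 ≤ ∑ i, (y i - ∑ j, X i j * b' j) ^ 2)
    (hlarge : k ≤ (Finset.univ.filter fun j => Real.sqrt (L / 2) * Real.sqrt v ≤ score X y j).card)
    (hcol : ∀ S : Finset (Fin p), S.card = k → ∑ i, (∑ j ∈ S, X i j) ^ 2 ≤ 4 * (k : ℝ))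
    (hexp : ∑ j, Real.exp (score X y j ^ 2 / (4 * v)) ≤ k * Real.exp (2 * L)) :
    k * L * v / 2048 ≤ ∑ j, b j ^ 2 := by
  classical
  have hk' : (0 : ℝ) < k := by exact_mod_cast hk
  set U := Real.sqrt (L / 2) * Real.sqrt v with hU
  have hU2 : U ^ 2 = L * v / 2 := by
    rw [hU, mul_pow, Real.sq_sqrt (by positivity), Real.sq_sqrt hv.le]
    ring
  have hU0 : 0 ≤ U := by positivity
  have hscore : ∀ w : Fin p → ℝ, ∑ i, y i * ∑ j, X i j * w j = ∑ j, w j * score X y j := fun w => by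
    simp only [score, Finset.mul_sum]
    rw [Finset.sum_comm]
    exact Finset.sum_congr rfl fun j _ => Finset.sum_congr rfl fun i _ => by ring
  have hexpand : ∀ w : Fin p → ℝ, ∑ i, (y i - ∑ j, X i j * w j) ^ 2 =
      ∑ i, y i ^ 2 - 2 * ∑ j, w j * score X y j + ∑ i, (∑ j, X i j * w j) ^ 2 := fun w => by
    rw [← hscore, Finset.mul_sum, ← Finset.sum_sub_distrib, ← Finset.sum_add_distrib]
    exact Finset.sum_congr rfl fun i _ => by ring
  obtain ⟨S, hSsub, hScard⟩ := Finset.exists_subset_card_eq hlarge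
  set b' : Fin p → ℝ := fun j => if j ∈ S then U / 4 else 0 with hb'
  have hb'0 : l0norm b' ≤ k := by
    rw [← hScard]
    refine Finset.card_le_card fun j hj => ?_
    by_contra hjS
    simp [hb', hjS] at hj
  have hXb' : ∀ i, ∑ j, X i j * b' j = U / 4 * ∑ j ∈ S, X i j := fun i => by
    simp only [hb', mul_ite, mul_zero, Finset.sum_ite_mem, Finset.univ_inter, Finset.mul_sum]
    exact Finset.sum_congr rfl fun j _ => by ring
  have hlin : U / 4 * (k * U) ≤ ∑ j, b' j * score X y j := by
    simp only [hb', ite_mul, zero_mul, Finset.sum_ite_mem, Finset.univ_inter, ← Finset.mul_sum]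
    gcongr
    rw [← hScard, ← nsmul_eq_mul]
    exact Finset.card_nsmul_le_sum _ _ _ fun j hj => (Finset.mem_filter.1 (hSsub hj)).2
  have hquad : ∑ i, (∑ j, X i j * b' j) ^ 2 ≤ (U / 4) ^ 2 * (4 * k) := by
    simp only [hXb', mul_pow, ← Finset.mul_sum]
    gcongr
    simpa [mul_pow] using hcol S hScard
  have hfit : k * L * v / 16 ≤ ∑ j, b j * score X y j := by
    have h := hopt b' hb'0
    rw [hexpand, hexpand] at h
    have h0 : 0 ≤ ∑ i, (∑ j, X i j * b j) ^ 2 := by positivity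
    have h1 : k * L * v = 2 * k * U ^ 2 := by
      rw [hU2]
      ring
    rw [h1]
    linarith
  set T := Finset.univ.filter fun j => b j ≠ 0 with hT
  have hTk : (T.card : ℝ) ≤ k := by exact_mod_cast hb
  have hTsum : ∑ j ∈ T, score X y j ^ 2 ≤ 8 * v * k * L := by
    have h1 : ∀ j, score X y j ^ 2 / (4 * v) ≤
        (2 * L - 1) + Real.exp (-(2 * L)) * Real.exp (score X y j ^ 2 / (4 * v)) := fun j => by
      rw [← Real.exp_add]
      have := Real.add_one_le_exp (-(2 * L) + score X y j ^ 2 / (4 * v))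
      linarith
    have h2 : ∑ j ∈ T, score X y j ^ 2 / (4 * v) ≤ 2 * L * k := by
      calc ∑ j ∈ T, score X y j ^ 2 / (4 * v)
          ≤ ∑ j ∈ T, ((2 * L - 1) +
            Real.exp (-(2 * L)) * Real.exp (score X y j ^ 2 / (4 * v))) :=
            Finset.sum_le_sum fun j _ => h1 j
        _ = T.card * (2 * L - 1) +
            Real.exp (-(2 * L)) * ∑ j ∈ T, Real.exp (score X y j ^ 2 / (4 * v)) := by
            rw [Finset.sum_add_distrib, Finset.mul_sum, Finset.sum_const, nsmul_eq_mul]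
        _ ≤ k * (2 * L - 1) + Real.exp (-(2 * L)) * (k * Real.exp (2 * L)) := by
            have h3 : ∑ j ∈ T, Real.exp (score X y j ^ 2 / (4 * v)) ≤ k * Real.exp (2 * L) :=
              (Finset.sum_le_univ_sum_of_nonneg fun j => by positivity).trans hexp
            have h4 : 0 ≤ 2 * L - 1 := by linarith
            gcongr
        _ = 2 * L * k := by
            rw [Real.exp_neg]
            field_simp
            ring
    rw [← Finset.sum_div, div_le_iff₀ (by positivity)] at h2
    linarith
  have hcs : (∑ j, b j * score X y j) ^ 2 ≤ (∑ j, b j ^ 2) * (8 * v * k * L) := by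
    have h1 : ∑ j, b j * score X y j = ∑ j ∈ T, b j * score X y j := by
      rw [hT, Finset.sum_filter]
      refine Finset.sum_congr rfl fun j _ => ?_
      by_cases hj : b j = 0 <;> simp [hj]
    rw [h1]
    refine (Finset.sum_mul_sq_le_sq_mul_sq _ _ _).trans (mul_le_mul ?_ hTsum ?_ ?_)
    · exact Finset.sum_le_univ_sum_of_nonneg fun j => by positivity
    · positivity
    · positivity
  have hpos : 0 < k * L * v := by positivity
  have h1 : (k * L * v / 16) ^ 2 ≤ (∑ j, b j ^ 2) * (8 * v * k * L) :=
    (pow_le_pow_left₀ (by positivity) hfit 2).trans hcs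
  have h2 : (k * L * v) * (k * L * v / 2048) ≤ (k * L * v) * ∑ j, b j ^ 2 := by
    linarith
  exact le_of_mul_le_mul_left h2 hpos

/-- With a fixed response, a best subset fit is large on average over the design. -/
lemma ofReal_le_lintegral_best_subset {n p k : ℕ} {y : Fin n → ℝ}
    {est : (Fin n → Fin p → ℝ) → Fin p → ℝ} (hest : Measurable est)
    (hk : 0 < k) (hn : 8 ≤ n) (hkp : 50176 * (k : ℝ) ≤ p) (hkn : k * Real.log p ≤ n / 4)
    (hsparse : ∀ X, l0norm (est X) ≤ k)
    (hopt : ∀ X (b : Fin p → ℝ), l0norm b ≤ k →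
      ∑ i, (y i - ∑ j, X i j * est X j) ^ 2 ≤ ∑ i, (y i - ∑ j, X i j * b j) ^ 2) :
    ENNReal.ofReal (k * Real.log (p / k) * ((∑ i, y i ^ 2) / n) / 4096) ≤
      ∫⁻ X, ENNReal.ofReal (∑ j, est X j ^ 2) ∂designMeasure n p := by
  have hk' : (0 : ℝ) < k := by exact_mod_cast hk
  have hn' : (8 : ℝ) ≤ n := by exact_mod_cast hn
  have hp' : (0 : ℝ) < p := lt_of_lt_of_le (by positivity) hkp
  set v := (∑ i, y i ^ 2) / n with hv
  rcases (show 0 ≤ v by positivity).eq_or_lt with hv0 | hv0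
  · simp [← hv0]
  set r : ℝ := p / k with hr
  have hr1 : 50176 ≤ r := (le_div_iff₀ hk').2 hkp
  have hr0 : 0 < r := by linarith
  have hpkr : (p : ℝ) = k * r := by
    rw [hr]
    field_simp
  have hsr : 224 ≤ Real.sqrt r := Real.le_sqrt_of_sq_le (by norm_num; exact hr1)
  set L := Real.log r with hL
  have hL1 : 1 ≤ L := by
    rw [hL, Real.le_log_iff_exp_le hr0]
    linarith [Real.exp_one_lt_d9]
  set U := Real.sqrt (L / 2) * Real.sqrt v with hU
  set few : Set (Fin n → Fin p → ℝ) :=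
    {X | (Finset.univ.filter fun j => U ≤ score X y j).card < k}
  set long : Set (Fin n → Fin p → ℝ) := {X | ∃ S : Finset (Fin p), S.card = k ∧
      4 * (k : ℝ) < ∑ i, (∑ j ∈ S, X i j) ^ 2}
  set heavy : Set (Fin n → Fin p → ℝ) :=
    {X | k * Real.exp (2 * L) ≤ ∑ j, Real.exp (score X y j ^ 2 / (4 * v))}
  have hfew : designMeasure n p few ≤ ENNReal.ofReal (1 / 8) := by
    have hvnn : ((∑ i, y i ^ 2) / n).toNNReal ≠ 0 := by simpa [← hv] using hv0
    have htail := gaussianReal_Ici_ge hvnn (Real.sqrt_nonneg (L / 2))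
    rw [Real.coe_toNNReal _ (by positivity), ← hv, Real.sq_sqrt (by positivity)] at htail
    have hexpL : Real.exp (-(L / 2)) = (Real.sqrt r)⁻¹ := by
      rw [Real.exp_neg, Real.exp_half, hL, Real.exp_log hr0]
    have hpq : (p : ℝ) * (Real.exp (-(L / 2)) / 7) = k * (Real.sqrt r / 7) := by
      rw [hexpL, hpkr]
      have h : Real.sqrt r * Real.sqrt r = r := Real.mul_self_sqrt hr0.le
      field_simp
      linarith
    have h := measure_card_lt_le (P := designMeasure n p) (g := fun j X => score X y j)
      (fun j => measurable_score y j) (fun j l hjl => indepFun_score_designMeasure y hjl)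
      (k := k) (by exact_mod_cast hp') (q := Real.exp (-(L / 2)) / 7) (by positivity)
      (map_score_designMeasure y) htail (by
        rw [hpq]
        nlinarith)
    refine h.trans (ENNReal.ofReal_le_ofReal ?_)
    rw [hpq, div_le_iff₀ (by positivity)]
    have hk1 : (1 : ℝ) ≤ k := by exact_mod_cast hk
    nlinarith
  have hlong : designMeasure n p long ≤ ENNReal.ofReal (1 / 4) := by
    refine (designMeasure_exists_sq_norm_sum_gt_le (by omega) hk (by exact_mod_cast hp')).trans
      (ENNReal.ofReal_le_ofReal ?_)
    calc Real.exp (k * Real.log p - n / 2) ≤ Real.exp (-2) := Real.exp_le_exp.2 (by linarith)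
      _ ≤ 1 / 4 := by
        rw [Real.exp_neg, one_div]
        apply inv_anti₀ (by norm_num)
        have h1 := Real.add_one_le_exp (1 : ℝ)
        have h2 : Real.exp 2 = Real.exp 1 * Real.exp 1 := by
          rw [← Real.exp_add]
          norm_num
        rw [h2]
        nlinarith
  have hheavy : designMeasure n p heavy ≤ ENNReal.ofReal (1 / 8) := by
    refine (designMeasure_sum_exp_ge_le y (c := k * Real.exp (2 * L)) (by positivity) hv.symm
      hv0).trans (ENNReal.ofReal_le_ofReal ?_)
    have h2 : Real.exp (2 * L) = r * r := by
      rw [two_mul, Real.exp_add, hL, Real.exp_log hr0]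
    have h3 : Real.sqrt 2 ≤ 2 := Real.sqrt_le_left (by norm_num) |>.2 (by norm_num)
    rw [h2, hpkr, div_le_iff₀ (by positivity)]
    have h4 : 0 < k * r := by positivity
    nlinarith
  have hgood : ∀ X, X ∉ few → X ∉ long → X ∉ heavy →
      k * L * v / 2048 ≤ ∑ j, est X j ^ 2 := fun X h1 h2 h3 =>
    le_sum_sq_of_best_subset hk hv0 hL1 (hsparse X) (hopt X) (not_lt.1 h1)
      (fun S hS => not_lt.1 fun h => h2 ⟨S, hS, h⟩) (not_le.1 h3).le
  set good : Set (Fin n → Fin p → ℝ) :=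
    {X | ENNReal.ofReal (k * L * v / 2048) ≤ ENNReal.ofReal (∑ j, est X j ^ 2)}
  have hcover : (1 : ℝ≥0∞) ≤ designMeasure n p good + ENNReal.ofReal (1 / 2) := by
    have hsub : (Set.univ : Set (Fin n → Fin p → ℝ)) ⊆ good ∪ (few ∪ (long ∪ heavy)) := by
      intro X _
      by_contra hX
      simp only [Set.mem_union, not_or] at hX
      exact hX.1 (ENNReal.ofReal_le_ofReal (hgood X hX.2.1 hX.2.2.1 hX.2.2.2))
    calc (1 : ℝ≥0∞) = designMeasure n p Set.univ := measure_univ.symm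
      _ ≤ designMeasure n p (good ∪ (few ∪ (long ∪ heavy))) := measure_mono hsub
      _ ≤ designMeasure n p good +
          (designMeasure n p few + (designMeasure n p long + designMeasure n p heavy)) :=
        (measure_union_le _ _).trans (add_le_add_right ((measure_union_le _ _).trans
          (add_le_add_right (measure_union_le _ _) _)) _)
      _ ≤ designMeasure n p good +
          (ENNReal.ofReal (1 / 8) + (ENNReal.ofReal (1 / 4) + ENNReal.ofReal (1 / 8))) := by
        gcongr
      _ = designMeasure n p good + ENNReal.ofReal (1 / 2) := by
        rw [← ENNReal.ofReal_add (by norm_num) (by norm_num),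
          ← ENNReal.ofReal_add (by norm_num) (by norm_num)]
        norm_num
  have hhalf : ENNReal.ofReal (1 / 2) ≤ designMeasure n p good := by
    have h1 : (1 : ℝ≥0∞) = ENNReal.ofReal (1 / 2) + ENNReal.ofReal (1 / 2) := by
      rw [← ENNReal.ofReal_add (by norm_num) (by norm_num)]
      norm_num
    rw [h1] at hcover
    exact (ENNReal.add_le_add_iff_right ENNReal.ofReal_ne_top).1 hcover
  calc ENNReal.ofReal (k * L * v / 4096)
      = ENNReal.ofReal (k * L * v / 2048) * ENNReal.ofReal (1 / 2) := by
        rw [← ENNReal.ofReal_mul (by positivity)]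
        congr 1
        ring
    _ ≤ ENNReal.ofReal (k * L * v / 2048) * designMeasure n p good := by gcongr
    _ ≤ ∫⁻ X, ENNReal.ofReal (∑ j, est X j ^ 2) ∂designMeasure n p :=
        mul_meas_ge_le_lintegral (by fun_prop) _

lemma lintegral_sum_sq_pi_gaussianReal (n : ℕ) :
    ∫⁻ z : Fin n → ℝ, ENNReal.ofReal (∑ i, z i ^ 2) ∂(Measure.pi fun _ => gaussianReal 0 1) = n := by
  have hone : ∀ i : Fin n, ∫⁻ z : Fin n → ℝ, ENNReal.ofReal (z i ^ 2)
      ∂(Measure.pi fun _ => gaussianReal 0 1) = 1 := fun i => by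
    have h1 := (measurePreserving_eval (fun _ : Fin n => gaussianReal 0 1) i).lintegral_comp
      (f := fun x => ENNReal.ofReal (x ^ 2)) (by fun_prop)
    simp only [Function.eval] at h1
    have hint : Integrable (fun x : ℝ => x ^ 2) (gaussianReal 0 1) :=
      (memLp_id_gaussianReal 2).integrable_sq
    rw [h1, ← ofReal_integral_eq_lintegral_ofReal hint (ae_of_all _ fun x => sq_nonneg x)]
    have h2 := variance_of_integral_eq_zero (μ := gaussianReal 0 1) (X := fun x => x)
      (by fun_prop) integral_id_gaussianReal
    rw [variance_fun_id_gaussianReal] at h2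
    rw [← h2]
    simp
  simp_rw [fun z : Fin n → ℝ => ENNReal.ofReal_sum_of_nonneg (s := Finset.univ)
    (f := fun i => z i ^ 2) fun i _ => sq_nonneg (z i)]
  rw [lintegral_finsetSum _ fun i _ => by fun_prop]
  simp [hone]

/-- Lower bound on the risk of best subset selection at the null signal. -/
lemma ofReal_le_risk_best_subset_zero {n p k : ℕ} {σ : ℝ}
    {bs : (Fin n → Fin p → ℝ) × (Fin n → ℝ) → Fin p → ℝ} (hbs : Measurable bs)
    (hk : 0 < k) (hn : 8 ≤ n) (hkp : 50176 * (k : ℝ) ≤ p) (hkn : k * Real.log p ≤ n / 4)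
    (hsparse : ∀ ω, l0norm (bs ω) ≤ k)
    (hopt : ∀ ω (b : Fin p → ℝ), l0norm b ≤ k →
      ∑ i, (ω.2 i - ∑ j, ω.1 i j * bs ω j) ^ 2 ≤ ∑ i, (ω.2 i - ∑ j, ω.1 i j * b j) ^ 2) :
    ENNReal.ofReal (k * Real.log (p / k) * σ ^ 2 / 4096) ≤ risk n p σ bs 0 := by
  have hn0 : (0 : ℝ) < n := by
    have : 0 < n := by omega
    exact_mod_cast this
  have hk' : (0 : ℝ) < k := by exact_mod_cast hk
  have hlog : 0 ≤ Real.log ((p : ℝ) / k) :=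
    Real.log_nonneg ((le_div_iff₀ hk').2 (by linarith))
  set C : ℝ := k * Real.log (p / k) * σ ^ 2 / 4096 with hC
  have hC0 : 0 ≤ C := by positivity
  unfold risk model
  simp only [Pi.zero_apply, mul_zero, Finset.sum_const_zero, zero_add, sub_zero]
  rw [lintegral_prod_symm _ (by fun_prop)]
  calc ENNReal.ofReal C
      = ENNReal.ofReal (C / n) * n := by
        rw [← ENNReal.ofReal_natCast, ← ENNReal.ofReal_mul (by positivity)]
        congr 1
        field_simp
    _ = ∫⁻ z : Fin n → ℝ, ENNReal.ofReal (C / n) * ENNReal.ofReal (∑ i, z i ^ 2)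
          ∂(Measure.pi fun _ => gaussianReal 0 1) := by
        rw [lintegral_const_mul _ (by fun_prop), lintegral_sum_sq_pi_gaussianReal]
    _ ≤ _ := by
        refine lintegral_mono fun z => ?_
        refine le_trans (le_of_eq ?_) (ofReal_le_lintegral_best_subset
          (y := fun i => σ * z i) (est := fun X => bs (X, fun i => σ * z i)) (by fun_prop)
          hk hn hkp hkn (fun X => hsparse _) fun X b hb => hopt (X, fun i => σ * z i) b hb)
        rw [← ENNReal.ofReal_mul (by positivity)]
        congr 1
        simp only [mul_pow, ← Finset.mul_sum, hC]
        ring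

/-- The zero estimator bounds the minimax risk. -/
lemma minimaxRisk_le (n p k : ℕ) (τ σ : ℝ) :
    minimaxRisk n p k τ σ ≤ ENNReal.ofReal (k * τ ^ 2) := by
  refine (iInf₂_le (fun _ => 0) measurable_const).trans (iSup₂_le fun β hβ => ?_)
  have : IsProbabilityMeasure (model n p) := by
    unfold model
    infer_instance
  unfold risk
  simp only [Pi.zero_apply, zero_sub, neg_sq, lintegral_const, measure_univ, mul_one]
  exact ENNReal.ofReal_le_ofReal hβ.2

/-- **Proposition 1 (suboptimality of best subset selection).** If `k/p → 0`,
`(k log p)/n → 0` and `τ/σ = o(√(log(p/k)))` (Regimes I–II), then for any best subset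
selection estimator (a measurable selection of the argmin of the residual sum of squares
over `k`-sparse vectors), the ratio of its supremum risk over `Θ(k,τ)` to the minimax
risk tends to infinity. -/
theorem best_subset_suboptimal
    (k p : ℕ → ℕ) (τ σ : ℕ → ℝ)
    (bs : ∀ n : ℕ, (Fin n → Fin (p n) → ℝ) × (Fin n → ℝ) → Fin (p n) → ℝ)
    (hk : ∀ n, 0 < k n) (hkp : ∀ n, k n ≤ p n)
    (hτ : ∀ n, 0 < τ n) (hσ : ∀ n, 0 < σ n)
    (hbs_meas : ∀ n, Measurable (bs n))
    (hbs_sparse : ∀ n ω, l0norm (bs n ω) ≤ k n)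
    (hbs_argmin : ∀ n ω (b : Fin (p n) → ℝ), l0norm b ≤ k n →
      ∑ i, (ω.2 i - ∑ j, ω.1 i j * bs n ω j) ^ 2 ≤ ∑ i, (ω.2 i - ∑ j, ω.1 i j * b j) ^ 2)
    (hkp0 : Tendsto (fun n => (k n : ℝ) / p n) atTop (nhds 0))
    (hklogp : Tendsto (fun n => (k n : ℝ) * Real.log (p n) / n) atTop (nhds 0))
    (hμo : Tendsto (fun n => (τ n / σ n) / Real.sqrt (Real.log ((p n : ℝ) / k n)))
      atTop (nhds 0)) :
    Tendsto (fun n => (⨆ β ∈ Theta (p n) (k n) (τ n), risk n (p n) (σ n) (bs n) β) /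
        minimaxRisk n (p n) (k n) (τ n) (σ n))
      atTop (nhds (⊤ : ℝ≥0∞)) := by
  have hp : ∀ n, (0 : ℝ) < p n := fun n => by exact_mod_cast (hk n).trans_le (hkp n)
  have hk' : ∀ n, (0 : ℝ) < k n := fun n => by exact_mod_cast hk n
  have hrat : Tendsto (fun n => ((p n : ℝ) / k n)) atTop atTop := by
    have h : Tendsto (fun n => ((k n : ℝ) / p n)⁻¹) atTop atTop :=
      (tendsto_nhdsWithin_iff.2 ⟨hkp0, Eventually.of_forall fun n =>
        div_pos (hk' n) (hp n)⟩).inv_tendsto_nhdsGT_zero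
    simpa using h
  have hlog : Tendsto (fun n => Real.log ((p n : ℝ) / k n)) atTop atTop :=
    Real.tendsto_log_atTop.comp hrat
  have hbig : Tendsto (fun n => Real.log ((p n : ℝ) / k n) * (σ n / τ n) ^ 2 / 4096)
      atTop atTop := by
    have h1 : Tendsto (fun n => ((τ n / σ n) / Real.sqrt (Real.log ((p n : ℝ) / k n)))⁻¹)
        atTop atTop := by
      refine (tendsto_nhdsWithin_iff.2 ⟨hμo, ?_⟩).inv_tendsto_nhdsGT_zero
      filter_upwards [hlog.eventually_gt_atTop 0] with n hn
      exact div_pos (div_pos (hτ n) (hσ n)) (Real.sqrt_pos.2 hn)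
    have h2 := ((tendsto_pow_atTop two_ne_zero).comp h1).atTop_div_const
      (show (0 : ℝ) < 4096 by norm_num)
    refine h2.congr' ?_
    filter_upwards [hlog.eventually_gt_atTop 0] with n hn
    simp only [Function.comp_apply, inv_div, div_pow, Real.sq_sqrt hn.le]
    field_simp
  refine tendsto_nhds_top_mono (ENNReal.tendsto_ofReal_atTop.comp hbig) ?_
  filter_upwards [eventually_ge_atTop 8, hrat.eventually_ge_atTop 50176,
    hklogp.eventually_le_const (show (0 : ℝ) < 1 / 4 by norm_num)] with n hn hr hkn
  have hn0 : (0 : ℝ) < n := by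
    have : 0 < n := by omega
    exact_mod_cast this
  have hrisk := ofReal_le_risk_best_subset_zero (σ := σ n) (hbs_meas n) (hk n) hn
    ((le_div_iff₀ (hk' n)).1 hr) (by linarith [(div_le_iff₀ hn0).1 hkn]) (hbs_sparse n)
    (hbs_argmin n)
  have hzero : (0 : Fin (p n) → ℝ) ∈ Theta (p n) (k n) (τ n) := by
    constructor
    · simp [l0norm]
    · simp only [Pi.zero_apply, ne_eq, OfNat.ofNat_ne_zero, not_false_eq_true, zero_pow,
        Finset.sum_const_zero]
      positivity
  have hden : 0 < (k n : ℝ) * τ n ^ 2 := mul_pos (hk' n) (pow_pos (hτ n) 2)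
  calc ENNReal.ofReal (Real.log ((p n : ℝ) / k n) * (σ n / τ n) ^ 2 / 4096)
      = ENNReal.ofReal (k n * Real.log ((p n : ℝ) / k n) * σ n ^ 2 / 4096) /
          ENNReal.ofReal (k n * τ n ^ 2) := by
        rw [← ENNReal.ofReal_div_of_pos hden]
        congr 1
        have h1 := (hk' n).ne'
        have h2 := (hτ n).ne'
        field_simp
    _ ≤ _ := ENNReal.div_le_div
        (hrisk.trans (le_iSup₂ (f := fun β _ => risk n (p n) (σ n) (bs n) β) 0 hzero))
        (minimaxRisk_le n (p n) (k n) (τ n) (σ n))
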